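/- arXiv:math/0212219 — 7 statements merged into one kernel-verified Lean document; each statement's English description precedes it below -/
import Mathlib

section
/- Improvement theorem (existence form): Let C be a monoidal category, x an object, x̄ an object, and suppose there exist isomorphisms i : 𝟙 ≅ x ⊗ x̄ and e : x̄ ⊗ x ≅ 𝟙. Then there exists an isomorphism i' : 𝟙 ≅ x ⊗ x̄ such that the duality data (x, x̄, i'.hom, e.hom) satisfies both the first and the second zig-zag identities; i.e. every weakly invertible object can be equipped with an adjoint equivalence (equivalently, x and x̄ form an exact pairing with invertible evaluation and coevaluation). -/
open CategoryTheory Category MonoidalCategory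

namespace CategoryTheory.Bicategory

variable {B : Type*} [Bicategory B] {a b : B} {f : a ⟶ b} {g : b ⟶ a}

theorem leftZigzag_eq (u : 𝟙 a ⟶ f ≫ g) (c : g ≫ f ⟶ 𝟙 b) :
    leftZigzag u c = u ▷ f ≫ (α_ f g f).hom ≫ f ◁ c := by
  simp [leftZigzag, bicategoricalComp]

theorem rightZigzag_eq (u : 𝟙 a ⟶ f ≫ g) (c : g ≫ f ⟶ 𝟙 b) :
    rightZigzag u c = g ◁ u ≫ (α_ g f g).inv ≫ c ▷ g := by
  simp [rightZigzag, bicategoricalComp]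

/-- The unit of an equivalence can be replaced, keeping the counit, so that both triangle
identities hold. -/
theorem exists_unit_triangles (u : 𝟙 a ≅ f ≫ g) (c : g ≫ f ≅ 𝟙 b) :
    ∃ u' : 𝟙 a ≅ f ≫ g,
      leftZigzag u'.hom c.hom = (Bicategory.leftUnitor f).hom ≫ (Bicategory.rightUnitor f).inv ∧
        rightZigzag u'.hom c.hom = (Bicategory.rightUnitor g).hom ≫ (Bicategory.leftUnitor g).inv := by
  have left := adjointifyCounit_left_triangle c.symm u.symm
  have right := right_triangle_of_left_triangle _ _ (congrArg Iso.hom left)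
  refine ⟨(adjointifyCounit c.symm u.symm).symm, ?_, ?_⟩
  · rw [← rightZigzagIso_hom] at right
    have h := congrArg Iso.inv
      (Iso.ext right : rightZigzagIso _ _ = Bicategory.rightUnitor f ≪≫ (Bicategory.leftUnitor f).symm)
    simpa using h
  · simpa using congrArg Iso.inv left

end CategoryTheory.Bicategory

/-- Improvement theorem (existence form): if `x` has a weak inverse `x̄`
(witnessed by isomorphisms `i : 𝟙 ≅ x ⊗ x̄` and `e : x̄ ⊗ x ≅ 𝟙`), then there is an
isomorphism `i' : 𝟙 ≅ x ⊗ x̄` such that `(x, x̄, i'.hom, e.hom)` satisfies both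
zig-zag identities, i.e. forms an adjoint equivalence. -/
theorem improvement_exists
    {C : Type*} [Category C] [MonoidalCategory C]
    (x xb : C) (i : 𝟙_ C ≅ x ⊗ xb) (e : xb ⊗ x ≅ 𝟙_ C) :
    ∃ i' : 𝟙_ C ≅ x ⊗ xb,
      (i'.hom ▷ x ≫ (α_ x xb x).hom ≫ x ◁ e.hom = (λ_ x).hom ≫ (ρ_ x).inv) ∧
      (xb ◁ i'.hom ≫ (α_ xb x xb).inv ≫ e.hom ▷ xb = (ρ_ xb).hom ≫ (λ_ xb).inv) := by
  obtain ⟨i', left, right⟩ := Bicategory.exists_unit_triangles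
    (B := MonoidalSingleObj C) (a := MonoidalSingleObj.star C) (b := MonoidalSingleObj.star C)
    (f := x) (g := xb) i e
  rw [Bicategory.leftZigzag_eq] at left
  rw [Bicategory.rightZigzag_eq] at right
  exact ⟨i', left, right⟩
end

section
/- Let C be a monoidal category, x, x̄ objects, and i : 𝟙 ≅ x ⊗ x̄, e : x̄ ⊗ x ≅ 𝟙 isomorphisms. Define i' : 𝟙 ⟶ x ⊗ x̄ as the composite i.hom ≫ (x ◁ λ_{x̄}.inv) ≫ (x ◁ (e.inv ▷ x̄)) ≫ (x ◁ α_{x̄,x,x̄}.hom) ≫ α_{x,x̄,x⊗x̄}.inv ≫ (i.inv ▷ (x ⊗ x̄)) ≫ λ_{x⊗x̄}.hom. Then the duality data (x, x̄, i', e.hom) satisfies the first zig-zag identity: (i' ▷ x) ≫ α_{x,x̄,x}.hom ≫ (x ◁ e.hom) = λ_x.hom ≫ ρ_x.inv. -/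
open CategoryTheory Category MonoidalCategory

/-- The explicitly improved unit `i'` together with the original counit `e`
satisfies the first zig-zag identity. -/
theorem improved_unit_first_zigzag
    {C : Type*} [Category C] [MonoidalCategory C]
    (x xb : C) (i : 𝟙_ C ≅ x ⊗ xb) (e : xb ⊗ x ≅ 𝟙_ C)
    (i' : 𝟙_ C ⟶ x ⊗ xb)
    (hi' : i' = i.hom ≫ x ◁ (λ_ xb).inv ≫ x ◁ (e.inv ▷ xb) ≫ x ◁ (α_ xb x xb).hom ≫
      (α_ x xb (x ⊗ xb)).inv ≫ i.inv ▷ (x ⊗ xb) ≫ (λ_ (x ⊗ xb)).hom) :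
    i' ▷ x ≫ (α_ x xb x).hom ≫ x ◁ e.hom = (λ_ x).hom ≫ (ρ_ x).inv := by
  subst hi'
  calc
    _ = 𝟙 _ ⊗≫ i.hom ▷ x ⊗≫ x ◁ e.inv ▷ xb ▷ x ⊗≫
          (i.inv ▷ (x ⊗ (xb ⊗ x)) ≫ 𝟙_ C ◁ x ◁ e.hom) ⊗≫ 𝟙 _ := by
      monoidal
    _ = 𝟙 _ ⊗≫ i.hom ▷ x ⊗≫ x ◁ (e.inv ▷ (xb ⊗ x) ≫ (xb ⊗ x) ◁ e.hom) ⊗≫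
          i.inv ▷ x ⊗≫ 𝟙 _ := by
      rw [← whisker_exchange i.inv (x ◁ e.hom)]; monoidal
    _ = 𝟙 _ ⊗≫ i.hom ▷ x ⊗≫ x ◁ (e.hom ≫ e.inv) ⊗≫ i.inv ▷ x ⊗≫ 𝟙 _ := by
      rw [← whisker_exchange e.inv e.hom]; monoidal
    _ = 𝟙 _ ⊗≫ (i.hom ≫ i.inv) ▷ x ⊗≫ 𝟙 _ := by
      rw [Iso.hom_inv_id]; monoidal
    _ = _ := by
      rw [Iso.hom_inv_id]; monoidal
end

section
/- Let C be a monoidal category, x, x̄ objects, and i : 𝟙 ⟶ x ⊗ x̄, e : x̄ ⊗ x ⟶ 𝟙 morphisms that are both isomorphisms. If the duality data (x, x̄, i, e) satisfies the first zig-zag identity, then it also satisfies the second zig-zag identity. -/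
open CategoryTheory Category MonoidalCategory

/-- For duality data with invertible unit and counit, the first zig-zag identity
implies the second. -/
theorem first_zigzag_implies_second
    {C : Type*} [Category C] [MonoidalCategory C]
    (x xb : C) (i : 𝟙_ C ⟶ x ⊗ xb) (e : xb ⊗ x ⟶ 𝟙_ C) [IsIso i] [IsIso e]
    (h1 : i ▷ x ≫ (α_ x xb x).hom ≫ x ◁ e = (λ_ x).hom ≫ (ρ_ x).inv) :
    xb ◁ i ≫ (α_ xb x xb).inv ≫ e ▷ xb = (ρ_ xb).hom ≫ (λ_ xb).inv := by
  let s : MonoidalSingleObj C := MonoidalSingleObj.star C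
  let f : s ⟶ s := x
  let g : s ⟶ s := xb
  let η : 𝟙 s ≅ f ≫ g := asIso i
  let ε : g ≫ f ≅ 𝟙 s := asIso e
  have h : Bicategory.leftZigzag η.hom ε.hom =
      (Bicategory.leftUnitor f).hom ≫ (Bicategory.rightUnitor f).inv := by
    simp only [Bicategory.leftZigzag, bicategoricalComp,
      BicategoricalCoherence.assoc_iso, BicategoricalCoherence.whiskerRight_iso,
      BicategoricalCoherence.refl_iso, Iso.trans_hom, Bicategory.whiskerRightIso_hom,
      Iso.refl_hom, Bicategory.whiskerRight_comp, Bicategory.id_whiskerRight, id_comp,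
      Iso.inv_hom_id, comp_id]
    exact h1
  have h2 := Bicategory.right_triangle_of_left_triangle η ε h
  simp only [Bicategory.rightZigzag, bicategoricalComp,
    BicategoricalCoherence.assoc'_iso, BicategoricalCoherence.whiskerRight_iso,
    BicategoricalCoherence.refl_iso, Iso.trans_hom, Bicategory.whiskerRightIso_hom,
    Iso.refl_hom, Bicategory.whiskerRight_comp, Bicategory.id_whiskerRight, id_comp,
    Iso.inv_hom_id, Iso.symm_hom] at h2
  exact h2
end

section
/- Let C be a monoidal category, x, x̄ objects, and i : 𝟙 ⟶ x ⊗ x̄, e : x̄ ⊗ x ⟶ 𝟙 morphisms that are both isomorphisms. If the duality data (x, x̄, i, e) satisfies the second zig-zag identity, then it also satisfies the first zig-zag identity. -/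
open CategoryTheory Category MonoidalCategory

/-- In a bicategory, for an invertible unit and counit, the right triangle identity
implies the left one. -/
theorem CategoryTheory.Bicategory.left_triangle_of_right_triangle
    {B : Type*} [Bicategory B] {a b : B} {f : a ⟶ b} {g : b ⟶ a}
    (η : 𝟙 a ≅ f ≫ g) (ε : g ≫ f ≅ 𝟙 b)
    (h : rightZigzag η.hom ε.hom = (rightUnitor g).hom ≫ (leftUnitor g).inv) :
    leftZigzag η.hom ε.hom = (leftUnitor f).hom ≫ (rightUnitor f).inv := by
  have h_iso : rightZigzagIso η ε = rightUnitor g ≪≫ (leftUnitor g).symm := Iso.ext h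
  have h_symm : leftZigzag ε.inv η.inv = (leftUnitor g).hom ≫ (rightUnitor g).inv :=
    (rightZigzagIso_inv η ε).symm.trans (congrArg Iso.inv h_iso)
  have h_right : rightZigzagIso ε.symm η.symm = rightUnitor f ≪≫ (leftUnitor f).symm :=
    Iso.ext (right_triangle_of_left_triangle ε.symm η.symm h_symm)
  exact (rightZigzagIso_inv ε.symm η.symm).symm.trans (congrArg Iso.inv h_right)

/-- For duality data with invertible unit and counit, the second zig-zag identity
implies the first. -/
theorem second_zigzag_implies_first
    {C : Type*} [Category C] [MonoidalCategory C]
    (x xb : C) (i : 𝟙_ C ⟶ x ⊗ xb) (e : xb ⊗ x ⟶ 𝟙_ C) [IsIso i] [IsIso e]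
    (h2 : xb ◁ i ≫ (α_ xb x xb).inv ≫ e ▷ xb = (ρ_ xb).hom ≫ (λ_ xb).inv) :
    i ▷ x ≫ (α_ x xb x).hom ≫ x ◁ e = (λ_ x).hom ≫ (ρ_ x).inv := by
  have h := Bicategory.left_triangle_of_right_triangle (a := MonoidalSingleObj.star C)
    (b := MonoidalSingleObj.star C) (f := x) (g := xb) (asIso i) (asIso e)
  simp only [bicategoricalComp, asIso_hom, BicategoricalCoherence.assoc'_iso,
    BicategoricalCoherence.whiskerRight_iso, BicategoricalCoherence.refl_iso, Iso.trans_hom,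
    Bicategory.whiskerRightIso_hom, Iso.refl_hom, Bicategory.whiskerRight_comp,
    Bicategory.id_whiskerRight, id_comp, Iso.inv_hom_id, Iso.symm_hom,
    BicategoricalCoherence.assoc_iso, comp_id] at h
  exact h h2
end

section
/- Let C, D be monoidal categories and F : C ⥤ D a strong monoidal functor. Let (x, x̄, i_x, e_x) be an adjoint equivalence in C and (F(x), y, i', e') an adjoint equivalence in D for the object F(x). Define F₋₁ : y ⟶ F(x̄) as the composite λ_y.inv ≫ ((e'⁻¹ : 𝟙_D ⟶ y ⊗ F(x)) ▷ y) ≫ α_{y,F(x),y}.hom ≫ (y ◁ (i'⁻¹ : F(x) ⊗ y ⟶ 𝟙_D)) ≫ (y ◁ F₀) ≫ (y ◁ F(i_x)) ≫ (y ◁ F₂⁻¹_{x,x̄}) ≫ α_{y,F(x),F(x̄)}.inv ≫ (e' ▷ F(x̄)) ≫ λ_{F(x̄)}.hom. Then F₋₁ satisfies the coherence law H1: i' ≫ (F(x) ◁ F₋₁) ≫ F₂_{x,x̄} = F₀ ≫ F(i_x) as morphisms 𝟙_D ⟶ F(x ⊗ x̄). -/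
open CategoryTheory Category MonoidalCategory Functor.LaxMonoidal Functor.OplaxMonoidal

/-- If `i` and `e` satisfy the first zig-zag identity, then the mate `y ⟶ z` of `g : 𝟙_ D ⟶ w ⊗ z`
under `e` transports `i` to `g`. -/
theorem unit_comp_whiskerLeft_mate {D : Type*} [Category D] [MonoidalCategory D]
    {w y z : D} (i : 𝟙_ D ⟶ w ⊗ y) (e : y ⊗ w ⟶ 𝟙_ D) (g : 𝟙_ D ⟶ w ⊗ z)
    (h : i ▷ w ≫ (α_ w y w).hom ≫ w ◁ e = (λ_ w).hom ≫ (ρ_ w).inv) :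
    i ≫ w ◁ ((ρ_ y).inv ≫ y ◁ g ≫ (α_ y w z).inv ≫ e ▷ z ≫ (λ_ z).hom) = g := by
  calc
    _ = (ρ_ (𝟙_ D)).inv ≫ (i ▷ 𝟙_ D ≫ (w ⊗ y) ◁ g) ≫ (α_ w y (w ⊗ z)).hom ≫
        w ◁ ((α_ y w z).inv ≫ e ▷ z ≫ (λ_ z).hom) := by monoidal
    _ = (ρ_ (𝟙_ D)).inv ≫ 𝟙_ D ◁ g ≫ (α_ (𝟙_ D) w z).inv ≫
        (i ▷ w ≫ (α_ w y w).hom ≫ w ◁ e) ▷ z ≫ (α_ w (𝟙_ D) z).hom ≫ w ◁ (λ_ z).hom := by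
      rw [← whisker_exchange]
      monoidal
    _ = g := by
      rw [h]
      monoidal

/-- The canonically defined comparison morphism `F₋₁ : y ⟶ F(x̄)` satisfies the
coherence law H1: `i' ≫ (F(x) ◁ F₋₁) ≫ F₂ = F₀ ≫ F(i_x)`. -/
theorem Fminus_one_satisfies_H1
    {C : Type*} [Category C] [MonoidalCategory C]
    {D : Type*} [Category D] [MonoidalCategory D]
    (F : C ⥤ D) [F.Monoidal]
    (x xb : C) (ix : 𝟙_ C ≅ x ⊗ xb) (ex : xb ⊗ x ≅ 𝟙_ C)
    (hx1 : ix.hom ▷ x ≫ (α_ x xb x).hom ≫ x ◁ ex.hom = (λ_ x).hom ≫ (ρ_ x).inv)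
    (hx2 : xb ◁ ix.hom ≫ (α_ xb x xb).inv ≫ ex.hom ▷ xb = (ρ_ xb).hom ≫ (λ_ xb).inv)
    (y : D) (i' : 𝟙_ D ≅ F.obj x ⊗ y) (e' : y ⊗ F.obj x ≅ 𝟙_ D)
    (h1 : i'.hom ▷ F.obj x ≫ (α_ (F.obj x) y (F.obj x)).hom ≫ F.obj x ◁ e'.hom =
      (λ_ (F.obj x)).hom ≫ (ρ_ (F.obj x)).inv)
    (h2 : y ◁ i'.hom ≫ (α_ y (F.obj x) y).inv ≫ e'.hom ▷ y = (ρ_ y).hom ≫ (λ_ y).inv)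
    (Fm1 : y ⟶ F.obj xb)
    (hFm1 : Fm1 = (λ_ y).inv ≫ e'.inv ▷ y ≫ (α_ y (F.obj x) y).hom ≫ y ◁ i'.inv ≫
      y ◁ ε F ≫ y ◁ F.map ix.hom ≫ y ◁ δ F x xb ≫ (α_ y (F.obj x) (F.obj xb)).inv ≫
      e'.hom ▷ F.obj xb ≫ (λ_ (F.obj xb)).hom) :
    i'.hom ≫ F.obj x ◁ Fm1 ≫ μ F x xb = ε F ≫ F.map ix.hom := by
  have zigzag_inv : e'.inv ▷ y ≫ (α_ y (F.obj x) y).hom ≫ y ◁ i'.inv =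
      (λ_ y).hom ≫ (ρ_ y).inv := by
    have h : whiskerLeftIso y i' ≪≫ (α_ y (F.obj x) y).symm ≪≫ whiskerRightIso e' y =
        ρ_ y ≪≫ (λ_ y).symm := Iso.ext h2
    simpa using congrArg Iso.inv h
  have mate_eq : Fm1 = (ρ_ y).inv ≫ y ◁ (ε F ≫ F.map ix.hom ≫ δ F x xb) ≫
      (α_ y (F.obj x) (F.obj xb)).inv ≫ e'.hom ▷ F.obj xb ≫ (λ_ (F.obj xb)).hom := by
    rw [hFm1, reassoc_of% zigzag_inv]
    simp only [Iso.inv_hom_id_assoc, MonoidalCategory.whiskerLeft_comp, assoc]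
  rw [mate_eq, ← assoc, unit_comp_whiskerLeft_mate i'.hom e'.hom _ h1]
  simp
end

section
/- Let C, D be monoidal categories and F : C ⥤ D a strong monoidal functor. Let (x, x̄, i_x, e_x) be an adjoint equivalence in C and (F(x), y, i', e') an adjoint equivalence in D for the object F(x). Define F₋₁ : y ⟶ F(x̄) as the composite λ_y.inv ≫ ((e'⁻¹ : 𝟙_D ⟶ y ⊗ F(x)) ▷ y) ≫ α_{y,F(x),y}.hom ≫ (y ◁ (i'⁻¹ : F(x) ⊗ y ⟶ 𝟙_D)) ≫ (y ◁ F₀) ≫ (y ◁ F(i_x)) ≫ (y ◁ F₂⁻¹_{x,x̄}) ≫ α_{y,F(x),F(x̄)}.inv ≫ (e' ▷ F(x̄)) ≫ λ_{F(x̄)}.hom. Then F₋₁ also satisfies the coherence law H2: (F₋₁ ▷ F(x)) ≫ F₂_{x̄,x} ≫ F(e_x) = e' ≫ F₀ as morphisms y ⊗ F(x) ⟶ F(𝟙_C). -/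
open CategoryTheory Category MonoidalCategory Functor.LaxMonoidal Functor.OplaxMonoidal

/-- Mating a pairing `e : y ⊗ a ⟶ 𝟙` with a coevaluation `j` and then evaluating with `k`
recovers `e`, as soon as `j` and `k` satisfy the zig-zag identity on `a`. -/
theorem mate_whiskerRight_comp_evaluation {D : Type*} [Category D] [MonoidalCategory D]
    {a b y : D} (j : 𝟙_ D ⟶ a ⊗ b) (k : b ⊗ a ⟶ 𝟙_ D) (e : y ⊗ a ⟶ 𝟙_ D)
    (h : j ▷ a ≫ (α_ a b a).hom ≫ a ◁ k = (λ_ a).hom ≫ (ρ_ a).inv) :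
    ((ρ_ y).inv ≫ y ◁ j ≫ (α_ y a b).inv ≫ e ▷ b ≫ (λ_ b).hom) ▷ a ≫ k = e := by
  calc
    _ = 𝟙 _ ⊗≫ y ◁ (j ▷ a) ⊗≫ (e ▷ (b ⊗ a) ≫ 𝟙_ D ◁ k) ⊗≫ 𝟙 _ := by monoidal
    _ = 𝟙 _ ⊗≫ y ◁ (j ▷ a ≫ (α_ a b a).hom ≫ a ◁ k) ⊗≫ e ⊗≫ 𝟙 _ := by
      rw [← whisker_exchange]
      monoidal
    _ = e := by
      rw [h]
      monoidal

/-- A strong monoidal functor preserves the zig-zag identity on `x`. -/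
theorem map_zigzag {C : Type*} [Category C] [MonoidalCategory C]
    {D : Type*} [Category D] [MonoidalCategory D] (F : C ⥤ D) [F.Monoidal]
    {x z : C} (i : 𝟙_ C ⟶ x ⊗ z) (e : z ⊗ x ⟶ 𝟙_ C)
    (h : i ▷ x ≫ (α_ x z x).hom ≫ x ◁ e = (λ_ x).hom ≫ (ρ_ x).inv) :
    (ε F ≫ F.map i ≫ δ F x z) ▷ F.obj x ≫ (α_ (F.obj x) (F.obj z) (F.obj x)).hom ≫
        F.obj x ◁ (μ F z x ≫ F.map e ≫ η F) =
      (λ_ (F.obj x)).hom ≫ (ρ_ (F.obj x)).inv := by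
  calc
    _ = ε F ▷ F.obj x ≫ μ F (𝟙_ C) x ≫
        F.map (i ▷ x ≫ (α_ x z x).hom ≫ x ◁ e) ≫ δ F x (𝟙_ C) ≫ F.obj x ◁ η F := by
      simp only [Functor.map_comp, Functor.Monoidal.map_associator,
        Functor.Monoidal.map_whiskerLeft, Functor.Monoidal.map_whiskerRight, comp_whiskerRight,
        MonoidalCategory.whiskerLeft_comp, assoc, Functor.Monoidal.μ_δ_assoc]
    _ = (λ_ (F.obj x)).hom ≫ (ρ_ (F.obj x)).inv := by
      rw [h]
      simp

/-- The canonically defined comparison morphism `F₋₁ : y ⟶ F(x̄)` satisfies the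
coherence law H2: `(F₋₁ ▷ F(x)) ≫ F₂ ≫ F(e_x) = e' ≫ F₀`. -/
theorem Fminus_one_satisfies_H2
    {C : Type*} [Category C] [MonoidalCategory C]
    {D : Type*} [Category D] [MonoidalCategory D]
    (F : C ⥤ D) [F.Monoidal]
    (x xb : C) (ix : 𝟙_ C ≅ x ⊗ xb) (ex : xb ⊗ x ≅ 𝟙_ C)
    (hx1 : ix.hom ▷ x ≫ (α_ x xb x).hom ≫ x ◁ ex.hom = (λ_ x).hom ≫ (ρ_ x).inv)
    (hx2 : xb ◁ ix.hom ≫ (α_ xb x xb).inv ≫ ex.hom ▷ xb = (ρ_ xb).hom ≫ (λ_ xb).inv)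
    (y : D) (i' : 𝟙_ D ≅ F.obj x ⊗ y) (e' : y ⊗ F.obj x ≅ 𝟙_ D)
    (h1 : i'.hom ▷ F.obj x ≫ (α_ (F.obj x) y (F.obj x)).hom ≫ F.obj x ◁ e'.hom =
      (λ_ (F.obj x)).hom ≫ (ρ_ (F.obj x)).inv)
    (h2 : y ◁ i'.hom ≫ (α_ y (F.obj x) y).inv ≫ e'.hom ▷ y = (ρ_ y).hom ≫ (λ_ y).inv)
    (Fm1 : y ⟶ F.obj xb)
    (hFm1 : Fm1 = (λ_ y).inv ≫ e'.inv ▷ y ≫ (α_ y (F.obj x) y).hom ≫ y ◁ i'.inv ≫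
      y ◁ ε F ≫ y ◁ F.map ix.hom ≫ y ◁ δ F x xb ≫ (α_ y (F.obj x) (F.obj xb)).inv ≫
      e'.hom ▷ F.obj xb ≫ (λ_ (F.obj xb)).hom) :
    Fm1 ▷ F.obj x ≫ μ F xb x ≫ F.map ex.hom = e'.hom ≫ ε F := by
  have h2' : e'.inv ▷ y ≫ (α_ y (F.obj x) y).hom ≫ y ◁ i'.inv = (λ_ y).hom ≫ (ρ_ y).inv := by
    rw [← cancel_epi (y ◁ i'.hom ≫ (α_ y (F.obj x) y).inv ≫ e'.hom ▷ y)]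
    trans 𝟙 _
    · simp
    · simp [reassoc_of% h2]
  have hF : Fm1 = (ρ_ y).inv ≫ y ◁ (ε F ≫ F.map ix.hom ≫ δ F x xb) ≫
      (α_ y (F.obj x) (F.obj xb)).inv ≫ e'.hom ▷ F.obj xb ≫ (λ_ (F.obj xb)).hom := by
    simp [hFm1, reassoc_of% h2']
  have h := mate_whiskerRight_comp_evaluation _ _ e'.hom (map_zigzag F ix.hom ex.hom hx1)
  rw [← hF] at h
  simp [← h]
end

section
/- Let C, D be monoidal categories and F : C ⥤ D a strong monoidal functor. Let (x, x̄, i_x, e_x) be an adjoint equivalence in C and (F(x), y, i', e') an adjoint equivalence in D for the object F(x). Then the two candidate definitions of F₋₁ : y ⟶ F(x̄) agree: λ_y.inv ≫ ((e'⁻¹) ▷ y) ≫ α_{y,F(x),y}.hom ≫ (y ◁ (i'⁻¹)) ≫ (y ◁ F₀) ≫ (y ◁ F(i_x)) ≫ (y ◁ F₂⁻¹_{x,x̄}) ≫ α_{y,F(x),F(x̄)}.inv ≫ (e' ▷ F(x̄)) ≫ λ_{F(x̄)}.hom = ρ_y.inv ≫ (y ◁ i') ≫ α_{y,F(x),y}.inv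 ≫ (e' ▷ y) ≫ (F₀ ▷ y) ≫ (F(e_x⁻¹) ▷ y) ≫ (F₂⁻¹_{x̄,x} ▷ y) ≫ α_{F(x̄),F(x),y}.hom ≫ (F(x̄) ◁ (i'⁻¹)) ≫ ρ_{F(x̄)}.hom. -/
open CategoryTheory Category MonoidalCategory Functor.LaxMonoidal Functor.OplaxMonoidal

/-- A monoidal functor sends an exact pairing to an exact pairing. -/
@[reducible]
def exactPairingMap {C : Type*} [Category C] [MonoidalCategory C]
    {D : Type*} [Category D] [MonoidalCategory D] (F : C ⥤ D) [F.Monoidal]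
    {x y : C} (p : ExactPairing x y) : ExactPairing (F.obj x) (F.obj y) where
  coevaluation' := ε F ≫ F.map p.coevaluation' ≫ δ F x y
  evaluation' := μ F y x ≫ F.map p.evaluation' ≫ η F
  evaluation_coevaluation' := by
    have h := congrArg (fun f => ε F ▷ F.obj x ≫ μ F (𝟙_ C) x ≫ F.map f ≫
      δ F x (𝟙_ C) ≫ F.obj x ◁ η F) p.evaluation_coevaluation'
    simp only [Functor.map_comp, Functor.Monoidal.map_whiskerLeft,
      Functor.Monoidal.map_whiskerRight, Functor.Monoidal.map_associator,
      Functor.Monoidal.map_leftUnitor, Functor.Monoidal.map_rightUnitor_inv, assoc,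
      Functor.Monoidal.μ_δ_assoc, Functor.Monoidal.whiskerRight_ε_η_assoc,
      Functor.Monoidal.whiskerLeft_ε_η, comp_id] at h
    simpa only [whiskerLeft_comp, comp_whiskerRight, assoc] using h
  coevaluation_evaluation' := by
    have h := congrArg (fun f => F.obj y ◁ ε F ≫ μ F y (𝟙_ C) ≫ F.map f ≫
      δ F (𝟙_ C) y ≫ η F ▷ F.obj y) p.coevaluation_evaluation'
    simp only [Functor.map_comp, Functor.Monoidal.map_whiskerLeft,
      Functor.Monoidal.map_whiskerRight, Functor.Monoidal.map_associator_inv,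
      Functor.Monoidal.map_leftUnitor_inv, Functor.Monoidal.map_rightUnitor, assoc,
      Functor.Monoidal.μ_δ_assoc, Functor.Monoidal.whiskerLeft_ε_η_assoc,
      Functor.Monoidal.whiskerRight_ε_η, comp_id] at h
    simpa only [whiskerLeft_comp, comp_whiskerRight, assoc] using h

/-- The comparison `y ⟶ z` between two right duals of `a` cancels the comparison `z ⟶ y`. -/
theorem rightDual_comparison_comp {D : Type*} [Category D] [MonoidalCategory D] {a y z : D}
    (p : ExactPairing a y) (q : ExactPairing a z) :
    ((ρ_ y).inv ≫ y ◁ q.coevaluation' ≫ (α_ y a z).inv ≫ p.evaluation' ▷ z ≫ (λ_ z).hom) ≫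
      ((ρ_ z).inv ≫ z ◁ p.coevaluation' ≫ (α_ z a y).inv ≫ q.evaluation' ▷ y ≫ (λ_ y).hom) =
    𝟙 y := by
  simpa [rightDualIso, rightAdjointMate, ExactPairing.coevaluation, ExactPairing.evaluation]
    using (rightDualIso p q).hom_inv_id

/-- The two candidate definitions of the comparison morphism `F₋₁ : y ⟶ F(x̄)`
(one built from the unit `i_x`, the other from the counit `e_x`) agree. -/
theorem Fminus_one_definitions_agree
    {C : Type*} [Category C] [MonoidalCategory C]
    {D : Type*} [Category D] [MonoidalCategory D]
    (F : C ⥤ D) [F.Monoidal]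
    (x xb : C) (ix : 𝟙_ C ≅ x ⊗ xb) (ex : xb ⊗ x ≅ 𝟙_ C)
    (hx1 : ix.hom ▷ x ≫ (α_ x xb x).hom ≫ x ◁ ex.hom = (λ_ x).hom ≫ (ρ_ x).inv)
    (hx2 : xb ◁ ix.hom ≫ (α_ xb x xb).inv ≫ ex.hom ▷ xb = (ρ_ xb).hom ≫ (λ_ xb).inv)
    (y : D) (i' : 𝟙_ D ≅ F.obj x ⊗ y) (e' : y ⊗ F.obj x ≅ 𝟙_ D)
    (h1 : i'.hom ▷ F.obj x ≫ (α_ (F.obj x) y (F.obj x)).hom ≫ F.obj x ◁ e'.hom =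
      (λ_ (F.obj x)).hom ≫ (ρ_ (F.obj x)).inv)
    (h2 : y ◁ i'.hom ≫ (α_ y (F.obj x) y).inv ≫ e'.hom ▷ y = (ρ_ y).hom ≫ (λ_ y).inv) :
    (λ_ y).inv ≫ e'.inv ▷ y ≫ (α_ y (F.obj x) y).hom ≫ y ◁ i'.inv ≫
      y ◁ ε F ≫ y ◁ F.map ix.hom ≫ y ◁ δ F x xb ≫ (α_ y (F.obj x) (F.obj xb)).inv ≫
      e'.hom ▷ F.obj xb ≫ (λ_ (F.obj xb)).hom =
    (ρ_ y).inv ≫ y ◁ i'.hom ≫ (α_ y (F.obj x) y).inv ≫ e'.hom ▷ y ≫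
      ε F ▷ y ≫ F.map ex.inv ▷ y ≫ δ F xb x ▷ y ≫ (α_ (F.obj xb) (F.obj x) y).hom ≫
      F.obj xb ◁ i'.inv ≫ (ρ_ (F.obj xb)).hom := by
  let p : ExactPairing (F.obj x) y := ⟨i'.hom, e'.hom, h2, h1⟩
  let q := exactPairingMap F (⟨ix.hom, ex.hom, hx2, hx1⟩ : ExactPairing x xb)
  have hpq := rightDual_comparison_comp p q
  have h_left : (λ_ y).inv ≫ e'.inv ▷ y ≫ (α_ y (F.obj x) y).hom ≫ y ◁ i'.inv = (ρ_ y).inv := by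
    let u := whiskerLeftIso y i' ≪≫ (α_ y (F.obj x) y).symm ≪≫ whiskerRightIso e' y
    have hu : u = ρ_ y ≪≫ (λ_ y).symm := Iso.ext h2
    have := congrArg Iso.inv hu
    simp only [u, Iso.trans_inv, Iso.symm_inv, whiskerLeftIso_inv, whiskerRightIso_inv,
      assoc] at this
    rw [this, Iso.inv_hom_id_assoc]
  rw [reassoc_of% h_left, reassoc_of% h2, Iso.inv_hom_id_assoc]
  let w : F.obj xb ≅ y := (ρ_ (F.obj xb)).symm ≪≫ whiskerLeftIso (F.obj xb) i' ≪≫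
    (α_ (F.obj xb) (F.obj x) y).symm ≪≫
    whiskerRightIso (Functor.Monoidal.μIso F xb x ≪≫ F.mapIso ex ≪≫
      (Functor.Monoidal.εIso F).symm) y ≪≫ λ_ y
  have h_w : w.hom = (ρ_ (F.obj xb)).inv ≫ F.obj xb ◁ p.coevaluation' ≫
      (α_ (F.obj xb) (F.obj x) y).inv ≫ q.evaluation' ▷ y ≫ (λ_ y).hom := rfl
  rw [← h_w] at hpq
  have h_inv : (ρ_ y).inv ≫ y ◁ (ε F ≫ F.map ix.hom ≫ δ F x xb) ≫
      (α_ y (F.obj x) (F.obj xb)).inv ≫ e'.hom ▷ F.obj xb ≫ (λ_ (F.obj xb)).hom = w.inv :=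
    (Iso.comp_hom_eq_id w).1 hpq
  simpa only [w, Iso.trans_inv, Iso.symm_inv, whiskerLeftIso_inv, whiskerRightIso_inv,
    Functor.mapIso_inv, Functor.Monoidal.μIso_inv, Functor.Monoidal.εIso_hom,
    whiskerLeft_comp, comp_whiskerRight, assoc] using h_inv
end
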